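/- Let G be a finite simple graph and let k be an integer. Define the graph H on the vertex set V(G) by making distinct vertices u and v adjacent in H if and only if there is no set S ⊆ V(G) ∖ {u, v} with |S| ≤ k such that u and v lie in different connected components of G ∖ S. If κ(H) ≤ k, then G = H. -/

import Mathlib

/-- `P` is a family of internally vertex-disjoint paths between `u` and `v` in `G`,
each having at least one internal vertex (i.e. length at least 2). -/
def InternallyDisjointPaths {V : Type*} (G : SimpleGraph V) {u v : V} {n : ℕ}
    (P : Fin n → G.Path u v) : Prop :=
  (∀ i, 2 ≤ (P i).val.length) ∧
    ∀ i j, i ≠ j →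
      List.Disjoint ((P i).val.support.tail.dropLast) ((P j).val.support.tail.dropLast)

/-- `κ(G, u, v)`: the maximum number of internally vertex-disjoint paths between
`u` and `v` in `G`, each having at least one internal vertex. -/
noncomputable def kappa {V : Type*} (G : SimpleGraph V) (u v : V) : ℕ :=
  sSup {n | ∃ P : Fin n → G.Path u v, InternallyDisjointPaths G P}

/-- `κ(G)`: the maximum of `κ(G, u, v)` over all pairs of distinct vertices. -/
noncomputable def kappaMax {V : Type*} (G : SimpleGraph V) : ℕ :=
  sSup {n | ∃ u v : V, u ≠ v ∧ kappa G u v = n}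

/-- `x` and `y` lie in the same connected component of `G ∖ S`, i.e. there is a
walk from `x` to `y` in `G` all of whose vertices avoid `S`. -/
def ConnAvoiding {V : Type*} (G : SimpleGraph V) (S : Set V) (x y : V) : Prop :=
  ∃ p : G.Walk x y, ∀ z ∈ p.support, z ∉ S

/-- `l` is the vertex list of a nonempty walk along `R` from a vertex of `A` to a vertex of `B`. -/
structure IsListWalk {V : Type*} (R : V → V → Prop) (A B : Set V) (l : List V) : Prop where
  isChain : l.IsChain R
  head : ∃ a ∈ A, a ∈ l.head?
  last : ∃ b ∈ B, b ∈ l.getLast?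

/-- Every walk along `R` from `A` to `B` meets `S`. -/
def Separates {V : Type*} (R : V → V → Prop) (A B S : Set V) : Prop :=
  ∀ l, IsListWalk R A B l → ∃ z ∈ l, z ∈ S

/-- There are `n` pairwise disjoint paths along `R` from `A` to `B`. -/
def HasLinkage {V : Type*} (R : V → V → Prop) (A B : Set V) (n : ℕ) : Prop :=
  ∃ p : Fin n → List V, (∀ i, IsListWalk R A B (p i) ∧ (p i).Nodup) ∧
    ∀ i j, i ≠ j → (p i).Disjoint (p j)

namespace IsListWalk

variable {V : Type*} {R R' : V → V → Prop} {A B P Q : Set V} {l l₁ l₂ : List V} {z : V}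

theorem mono (hR : ∀ a b, R a b → R' a b) (h : IsListWalk R A B l) : IsListWalk R' A B l :=
  ⟨h.isChain.imp hR, h.head, h.last⟩

theorem reverse (h : IsListWalk R A B l) : IsListWalk (fun a b => R b a) B A l.reverse := by
  refine ⟨?_, ?_, ?_⟩
  · rw [List.isChain_reverse]
    exact h.isChain
  · simpa using h.last
  · simpa using h.head

theorem takeUntil (h : IsListWalk R A B (l₁ ++ z :: l₂)) :
    IsListWalk R A {z} (l₁ ++ [z]) := by
  refine ⟨(List.isChain_split.1 h.isChain).1, ?_, by simp⟩
  have := h.head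
  cases l₁ <;> simpa using this

theorem dropUntil (h : IsListWalk R A B (l₁ ++ z :: l₂)) :
    IsListWalk R {z} B (z :: l₂) := by
  refine ⟨(List.isChain_split.1 h.isChain).2, by simp, ?_⟩
  simpa using h.last

theorem glue (h₁ : IsListWalk R A P (l₁ ++ [z])) (h₂ : IsListWalk R Q B (z :: l₂)) :
    IsListWalk R A B (l₁ ++ z :: l₂) := by
  refine ⟨List.isChain_split.2 ⟨h₁.isChain, h₂.isChain⟩, ?_, ?_⟩
  · have := h₁.head
    cases l₁ <;> simpa using this
  · simpa using h₂.last

theorem exists_walk_to_first_hit (hR : ∀ a b, R a b → a ∉ P → R' a b) (h : IsListWalk R A B l)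
    (hit : ∃ z ∈ l, z ∈ P) : ∃ l', l' ⊆ l ∧ IsListWalk R' A P l' := by
  classical
  obtain ⟨s, hs⟩ : ∃ s, l.find? (fun z => decide (z ∈ P)) = some s := by
    rw [← Option.isSome_iff_exists, List.find?_isSome]
    simpa using hit
  obtain ⟨hsP, l₁, l₂, rfl, hl₁⟩ := List.find?_eq_some_iff_append.1 hs
  simp only [decide_eq_true_eq, Bool.not_eq_true', decide_eq_false_iff_not] at hsP hl₁
  have hw := h.takeUntil
  refine ⟨l₁ ++ [s], by simp, ?_, hw.head, s, hsP, by simp⟩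
  rw [List.isChain_iff_forall_rel_of_append_cons_cons]
  intro a b m₁ m₂ e
  refine hR a b (List.isChain_iff_forall_rel_of_append_cons_cons.1 hw.isChain e) (hl₁ a ?_)
  rcases List.eq_nil_or_concat m₂ with rfl | ⟨m₃, c, rfl⟩
  · have e' : l₁ ++ [s] = (m₁ ++ [a]) ++ [b] := by simpa using e
    rw [(List.append_inj' e' rfl).1]
    simp
  · have e' : l₁ ++ [s] = (m₁ ++ a :: b :: m₃) ++ [c] := by simpa using e
    rw [(List.append_inj' e' rfl).1]
    simp

theorem exists_walk_from_last_hit (hR : ∀ a b, R a b → b ∉ Q → R' a b) (h : IsListWalk R A B l)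
    (hit : ∃ z ∈ l, z ∈ Q) : ∃ l', l' ⊆ l ∧ IsListWalk R' Q B l' := by
  obtain ⟨l', hl', hw⟩ := h.reverse.exists_walk_to_first_hit (P := Q) (R' := fun a b => R' b a)
    (fun a b => hR b a) (by simpa using hit)
  exact ⟨l'.reverse, fun z hz => by simpa using hl' (List.mem_reverse.1 hz), hw.reverse⟩

end IsListWalk

/-- If `S` separates `A` from `B`, a path from `A` that meets `S` at most in its last vertex and
a path to `B` that meets `S` at most in its first vertex meet only in `S`. -/
theorem Separates.mem_of_mem_of_mem {V : Type*} {R : V → V → Prop} {A B P Q S : Set V}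
    (hS : Separates R A B S) {p q : List V} (hp : IsListWalk R A P p) (hq : IsListWalk R Q B q)
    (hpn : p.Nodup) (hqn : q.Nodup) (hpS : ∀ s ∈ p, s ∈ S → s ∈ p.getLast?)
    (hqS : ∀ s ∈ q, s ∈ S → s ∈ q.head?) {z : V} (hzp : z ∈ p) (hzq : z ∈ q) : z ∈ S := by
  obtain ⟨p₁, p₂, rfl⟩ := List.append_of_mem hzp
  obtain ⟨q₁, q₂, rfl⟩ := List.append_of_mem hzq
  obtain ⟨s, hs, hsS⟩ := hS _ (hp.takeUntil.glue hq.dropUntil)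
  by_cases hsz : s = z
  · exact hsz ▸ hsS
  rcases List.mem_append.1 hs with h | h
  · have hl := hpS s (by simp [h]) hsS
    rw [List.getLast?_append_of_ne_nil _ (by simp)] at hl
    exact absurd rfl ((List.nodup_append.1 hpn).2.2 s h s (List.mem_of_getLast? hl))
  · have hsq : s ∈ q₂ := by simpa [hsz] using h
    have hl := hqS s (by simp [hsq]) hsS
    cases q₁ with
    | nil => simp at hl; exact absurd hl.symm hsz
    | cons c q₁ =>
      have hc : c = s := by simpa using hl
      subst hc
      simp [hsq] at hqn

/-- A path to a vertex of `insert x S` and a path from the matching vertex of `insert y S` can be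
joined, through the edge `(x, y)` when the first path ends in `x`. -/
theorem exists_join {V : Type*} [DecidableEq V] {R R' : V → V → Prop} {A B P Q S : Set V}
    {x y s : V} (hR : ∀ a b, R a b → R' a b) (hxy : R' x y)
    {p q : List V} (hp : IsListWalk R A P p) (hq : IsListWalk R Q B q)
    (hpn : p.Nodup) (hqn : q.Nodup) (hps : s ∈ p.getLast?)
    (hqs : (if s = x then y else s) ∈ q.head?)
    (hmeet : ∀ z ∈ p, z ∈ q → z ∈ S ∧ z ∈ p.getLast?) (hxS : x ∉ S) :
    ∃ r, (IsListWalk R' A B r ∧ r.Nodup) ∧ ∀ z ∈ r, z ∈ p ∨ z ∈ q := by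
  obtain ⟨p, rfl⟩ := List.getLast?_eq_some_iff.1 hps
  obtain ⟨q, rfl⟩ := List.head?_eq_some_iff.1 hqs
  split_ifs at * with h
  · subst h
    refine ⟨p ++ s :: y :: q, ⟨⟨?_, ?_, ?_⟩, ?_⟩, by simp; tauto⟩
    · exact List.isChain_append_cons_cons.2
        ⟨(hp.mono hR).isChain, hxy, (hq.mono hR).isChain⟩
    · have := hp.head
      cases p <;> simpa using this
    · simpa using hq.last
    · have hd : (p ++ [s]).Disjoint (y :: q) := by
        intro z hz hz'
        obtain ⟨hzS, hzl⟩ := hmeet z hz hz'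
        have : s = z := by simpa using hzl
        exact hxS (this ▸ hzS)
      simpa using List.Nodup.append hpn hqn hd
  · refine ⟨p ++ s :: q, ⟨(hp.mono hR).glue (hq.mono hR), ?_⟩, by simp; tauto⟩
    refine List.Nodup.append hpn.of_append_left hqn fun z hz hz' => ?_
    have : s = z := by simpa using (hmeet z (by simp [hz]) hz').2
    subst this
    exact (List.nodup_append.1 hpn).2.2 s hz s (by simp) rfl

/-- In a family of `n` disjoint paths ending in a set of `n` vertices, every vertex of that set
is the last vertex of a path, and each path meets the set only there. -/
theorem linkage_last {V : Type*} {R : V → V → Prop} {A : Set V} {P : Finset V} {n : ℕ}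
    {p : Fin n → List V} (hp : ∀ i, IsListWalk R A P (p i))
    (hd : ∀ i j, i ≠ j → (p i).Disjoint (p j)) (hn : P.card = n) :
    (∀ s ∈ P, ∃ i, s ∈ (p i).getLast?) ∧ ∀ i, ∀ s ∈ p i, s ∈ P → s ∈ (p i).getLast? := by
  classical
  choose e heP he using fun i => (hp i).last
  have hmem : ∀ i, e i ∈ p i := fun i => List.mem_of_getLast? (he i)
  have hinj : Function.Injective e := by
    intro i j hij
    by_contra hne
    exact hd i j hne (hmem i) (hij ▸ hmem j)
  have hsurj : ∀ s ∈ P, ∃ i, e i = s := by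
    have : Finset.univ.image e = P := Finset.eq_of_subset_of_card_le
      (fun s hs => by
        obtain ⟨i, -, rfl⟩ := Finset.mem_image.1 hs
        exact heP i)
      (by rw [Finset.card_image_of_injective _ hinj]; simp [hn])
    intro s hs
    simpa [← this] using hs
  refine ⟨fun s hs => ?_, fun i s hs hsP => ?_⟩
  · obtain ⟨i, rfl⟩ := hsurj s hs
    exact ⟨i, he i⟩
  obtain ⟨j, rfl⟩ := hsurj s hsP
  by_cases hij : i = j
  · exact hij ▸ he i
  · exact (hd i j hij hs (hmem j)).elim

/-- The analogue of `linkage_last` for first vertices. -/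
theorem linkage_head {V : Type*} {R : V → V → Prop} {B : Set V} {Q : Finset V} {n : ℕ}
    {q : Fin n → List V} (hq : ∀ i, IsListWalk R Q B (q i))
    (hd : ∀ i j, i ≠ j → (q i).Disjoint (q j)) (hn : Q.card = n) :
    (∀ s ∈ Q, ∃ i, s ∈ (q i).head?) ∧ ∀ i, ∀ s ∈ q i, s ∈ Q → s ∈ (q i).head? := by
  simpa using linkage_last (fun i => (hq i).reverse)
    (fun i j hij z hz hw => hd i j hij (List.mem_reverse.1 hz) (List.mem_reverse.1 hw)) hn

/-- **Menger's theorem** for finite directed graphs, in its version for two sets of vertices. -/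
theorem menger {V : Type*} [DecidableEq V] (E : Finset (V × V)) (A B : Finset V) (n : ℕ)
    (h : ∀ S : Finset V, Separates (fun a b => (a, b) ∈ E) A B S → n ≤ S.card) :
    HasLinkage (fun a b => (a, b) ∈ E) A B n := by
  induction E using Finset.induction_on generalizing A B n with
  | empty =>
    have hn : n ≤ (A ∩ B).card := by
      refine h _ fun l hl => ?_
      obtain ⟨hc, ⟨a, ha, hal⟩, b, hb, hbl⟩ := hl
      match l, hc with
      | [c], _ =>
        simp only [List.head?_cons, List.getLast?_singleton, Option.mem_some] at hal hbl
        subst hal hbl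
        exact ⟨c, by simp, by simpa using ⟨ha, hb⟩⟩
      | c :: d :: l, hc => simp at hc
    obtain ⟨T, hT, hTn⟩ := Finset.exists_subset_card_eq hn
    let e := T.equivFinOfCardEq hTn
    refine ⟨fun i => [(e.symm i : V)], fun i => ⟨⟨by simp, ?_, ?_⟩, by simp⟩, ?_⟩
    · exact ⟨_, (Finset.mem_inter.1 (hT (e.symm i).2)).1, by simp⟩
    · exact ⟨_, (Finset.mem_inter.1 (hT (e.symm i).2)).2, by simp⟩
    · intro i j hij
      simpa [Subtype.coe_inj] using fun h => hij h.symm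
  | insert xy E _ ih =>
    obtain ⟨x, y⟩ := xy
    have hmono : ∀ a b, (a, b) ∈ E → (a, b) ∈ insert (x, y) E :=
      fun a b => Finset.mem_insert_of_mem
    by_cases hsep : ∀ S : Finset V, Separates (fun a b => (a, b) ∈ E) A B S → n ≤ S.card
    · obtain ⟨p, hp, hd⟩ := ih A B n hsep
      exact ⟨p, fun i => ⟨(hp i).1.mono hmono, (hp i).2⟩, hd⟩
    push Not at hsep
    obtain ⟨S, hS, hSn⟩ := hsep
    have hPS : Separates (fun a b => (a, b) ∈ insert (x, y) E) A B (insert x S : Finset V) := by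
      intro l hl
      by_contra! hno
      have hl' : IsListWalk (fun a b => (a, b) ∈ E) A B l := by
        refine ⟨hl.isChain.imp_of_mem_imp fun a b ha _ hab => ?_, hl.head, hl.last⟩
        rcases Finset.mem_insert.1 hab with h | h
        · simp only [Prod.mk.injEq] at h
          exact (hno a ha (by simp [h.1])).elim
        · exact h
      obtain ⟨z, hz, hzS⟩ := hS l hl'
      exact hno z hz (by simpa using Or.inr hzS)
    have hQS : Separates (fun a b => (a, b) ∈ insert (x, y) E) A B (insert y S : Finset V) := by
      intro l hl
      by_contra! hno
      have hl' : IsListWalk (fun a b => (a, b) ∈ E) A B l := by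
        refine ⟨hl.isChain.imp_of_mem_imp fun a b _ hb hab => ?_, hl.head, hl.last⟩
        rcases Finset.mem_insert.1 hab with h | h
        · simp only [Prod.mk.injEq] at h
          exact (hno b hb (by simp [h.2])).elim
        · exact h
      obtain ⟨z, hz, hzS⟩ := hS l hl'
      exact hno z hz (by simpa using Or.inr hzS)
    have hxS : x ∉ S := fun hx => by
      have := h _ hPS
      rw [Finset.insert_eq_of_mem hx] at this
      omega
    have hyS : y ∉ S := fun hy => by
      have := h _ hQS
      rw [Finset.insert_eq_of_mem hy] at this
      omega
    have hPn : (insert x S).card = n := by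
      have := h _ hPS
      rw [Finset.card_insert_of_notMem hxS] at this ⊢
      omega
    have hQn : (insert y S).card = n := by
      rw [← hPn, Finset.card_insert_of_notMem hxS, Finset.card_insert_of_notMem hyS]
    obtain ⟨p, hp, hpd⟩ := ih A (insert x S) n fun T hT => h T fun l hl => by
      obtain ⟨l', hl', hw⟩ := hl.exists_walk_to_first_hit (P := (insert x S : Finset V))
        (R' := fun a b => (a, b) ∈ E) (fun a b hab ha => by
          rcases Finset.mem_insert.1 hab with h | h
          · simp only [Prod.mk.injEq] at h
            exact (ha (by simp [h.1])).elim
          · exact h) (hPS l hl)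
      exact (hT l' hw).imp fun z hz => ⟨hl' hz.1, hz.2⟩
    obtain ⟨q, hq, hqd⟩ := ih (insert y S) B n fun T hT => h T fun l hl => by
      obtain ⟨l', hl', hw⟩ := hl.exists_walk_from_last_hit (Q := (insert y S : Finset V))
        (R' := fun a b => (a, b) ∈ E) (fun a b hab hb => by
          rcases Finset.mem_insert.1 hab with h | h
          · simp only [Prod.mk.injEq] at h
            exact (hb (by simp [h.2])).elim
          · exact h) (hQS l hl)
      exact (hT l' hw).imp fun z hz => ⟨hl' hz.1, hz.2⟩
    have hpl := (linkage_last (fun i => (hp i).1) hpd hPn).2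
    obtain ⟨hqx, hql⟩ := linkage_head (fun i => (hq i).1) hqd hQn
    have hmeet : ∀ i j, ∀ z ∈ p i, z ∈ q j → z ∈ S := fun i j z hzp hzq =>
      hS.mem_of_mem_of_mem (hp i).1 (hq j).1 (hp i).2 (hq j).2
        (fun s hs hsS => hpl i s hs (Finset.mem_insert_of_mem hsS))
        (fun s hs hsS => hql j s hs (Finset.mem_insert_of_mem hsS)) hzp hzq
    choose s hsP hs using fun i => (hp i).1.last
    have hsP' : ∀ i, s i = x ∨ s i ∈ S := fun i => by simpa using hsP i
    have hfQ : ∀ i, (if s i = x then y else s i) ∈ insert y S := fun i => by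
      rcases hsP' i with h | h
      · simp [h]
      · split_ifs <;> simp [h]
    choose m hm using fun i => hqx _ (hfQ i)
    choose r hr hrm using fun i => exists_join hmono (Finset.mem_insert_self _ _) (hp i).1
      (hq (m i)).1 (hp i).2 (hq (m i)).2 (hs i) (hm i)
      (fun z hz hz' => ⟨hmeet i _ z hz hz',
        hpl i z hz (Finset.mem_insert_of_mem (hmeet i _ z hz hz'))⟩) hxS
    have hs_inj : ∀ i j, s i = s j → i = j := by
      intro i j hij
      by_contra hne
      exact hpd i j hne (List.mem_of_getLast? (hs i)) (hij ▸ List.mem_of_getLast? (hs j))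
    have hcross : ∀ i j z, z ∈ p i → z ∈ q (m j) → i = j := by
      intro i j z hz hz'
      have hzS := hmeet _ _ z hz hz'
      have h₁ : s i = z := Option.mem_unique (hs i) (hpl i z hz (Finset.mem_insert_of_mem hzS))
      have h₂ : (if s j = x then y else s j) = z :=
        Option.mem_unique (hm j) (hql _ z hz' (Finset.mem_insert_of_mem hzS))
      split_ifs at h₂ with hj
      · exact (hyS (h₂ ▸ hzS)).elim
      · exact hs_inj i j (h₁.trans h₂.symm)
    refine ⟨r, hr, fun i j hij z hz hz' => hij ?_⟩
    rcases hrm i z hz with h₁ | h₁ <;> rcases hrm j z hz' with h₂ | h₂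
    · by_contra hne
      exact hpd i j hne h₁ h₂
    · exact hcross i j z h₁ h₂
    · exact (hcross j i z h₂ h₁).symm
    · have hmm : m i = m j := by
        by_contra hne
        exact hqd _ _ hne h₁ h₂
      have hi := hm i
      rw [hmm] at hi
      have hf := Option.mem_unique hi (hm j)
      apply hs_inj
      have hi' := hsP' i
      have hj' := hsP' j
      split_ifs at hf with h₃ h₄ h₄
      · rw [h₃, h₄]
      · exact (hyS (hf ▸ hj'.resolve_left h₄)).elim
      · exact (hyS (hf ▸ hi'.resolve_left h₃)).elim
      · exact hf

theorem exists_path_of_isChain {V : Type*} {G : SimpleGraph V} {u v : V} {l : List V}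
    (hc : (u :: (l ++ [v])).IsChain G.Adj) (hn : (u :: (l ++ [v])).Nodup) :
    ∃ P : G.Path u v, P.val.support = u :: (l ++ [v]) := by
  obtain ⟨w, hw⟩ : ∃ w : G.Walk u v, w.support = u :: (l ++ [v]) := by
    have hv : (u :: (l ++ [v])).getLast (List.cons_ne_nil _ _) = v := by simp
    refine ⟨(SimpleGraph.Walk.ofSupport _ (List.cons_ne_nil _ _) hc).copy (List.head_cons) hv, ?_⟩
    exact (SimpleGraph.Walk.support_copy _ _ _).trans (SimpleGraph.Walk.support_ofSupport _ hc)
  exact ⟨⟨w, w.isPath_def.2 (hw ▸ hn)⟩, hw⟩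

/-- **Menger's theorem** for internally disjoint paths between two nonadjacent vertices. -/
theorem exists_internallyDisjointPaths {V : Type*} [Fintype V] {G : SimpleGraph V} {u v : V}
    (huv : u ≠ v) (hadj : ¬ G.Adj u v) {n : ℕ}
    (h : ∀ S : Finset V, u ∉ S → v ∉ S → ¬ ConnAvoiding G ↑S u v → n ≤ S.card) :
    ∃ P : Fin n → G.Path u v, InternallyDisjointPaths G P := by
  classical
  let E : Finset (V × V) := {e | G.Adj e.1 e.2 ∧ (e.1 ≠ u ∧ e.1 ≠ v) ∧ e.2 ≠ u ∧ e.2 ≠ v}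
  have hE : ∀ a b, (a, b) ∈ E ↔ G.Adj a b ∧ (a ≠ u ∧ a ≠ v) ∧ b ≠ u ∧ b ≠ v := by simp [E]
  obtain ⟨p, hp, hd⟩ := menger E {a | G.Adj u a} {b | G.Adj b v} n fun S hS => by
    refine (h (S \ {u, v}) (by simp) (by simp) ?_).trans (Finset.card_le_card Finset.sdiff_subset)
    rintro ⟨w, hw⟩
    obtain ⟨m, hm⟩ : ∃ m, w.bypass.support = u :: (m ++ [v]) := by
      cases hb : w.bypass with
      | nil => exact (huv rfl).elim
      | cons ha t =>
        have hv : t.support.getLast? = some v := by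
          rw [List.getLast?_eq_some_getLast t.support_ne_nil, t.getLast_support]
        obtain ⟨m, hm⟩ := List.getLast?_eq_some_iff.1 hv
        exact ⟨m, by simp [hm]⟩
    have hc := w.bypass.isChain_adj_support
    have hn := w.bypass_isPath.support_nodup
    rw [hm] at hc hn
    have hmem : ∀ z ∈ m, z ≠ u ∧ z ≠ v := by
      intro z hz
      refine ⟨?_, ?_⟩ <;> rintro rfl
      · simp [hz] at hn
      · simp only [List.nodup_cons, List.nodup_append] at hn
        exact hn.2.2.2 z hz z (by simp) rfl
    have hne : m ≠ [] := by
      rintro rfl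
      simp [hadj] at hc
    have hwalk : IsListWalk (fun a b => (a, b) ∈ E) {a | G.Adj u a} {b | G.Adj b v} m := by
      refine ⟨?_, ?_, ?_⟩
      · exact (hc.of_cons.left_of_append).imp_of_mem_imp
          fun a b ha hb hab => (hE a b).2 ⟨hab, hmem a ha, hmem b hb⟩
      · obtain ⟨a, m, rfl⟩ := List.exists_cons_of_ne_nil hne
        exact ⟨a, by simpa using hc.rel, by simp⟩
      · rcases List.eq_nil_or_concat m with rfl | ⟨m, b, rfl⟩
        · exact (hne rfl).elim
        · refine ⟨b, ?_, by simp⟩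
          have : (u :: m ++ b :: v :: []).IsChain G.Adj := by simpa using hc
          simpa using (List.isChain_append_cons_cons.1 this).2.1
    obtain ⟨z, hz, hzS⟩ := hS m (by simpa using hwalk)
    refine hw z (w.support_bypass_subset_support ?_) ?_
    · simp [hm, hz]
    · simpa [hmem z hz] using hzS
  have hpath : ∀ i, ∃ P : G.Path u v, P.val.support = u :: (p i ++ [v]) := by
    intro i
    obtain ⟨⟨hc, ⟨a, ha, hal⟩, b, hb, hbl⟩, hn⟩ := hp i
    simp only [Finset.coe_filter, Finset.mem_univ, true_and, Set.mem_ofPred_eq] at ha hb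
    have hmem : ∀ z ∈ p i, z ≠ u ∧ z ≠ v := by
      intro z hz
      obtain ⟨l₁, l₂, e⟩ := List.append_of_mem hz
      rcases List.eq_nil_or_concat l₁ with rfl | ⟨l₁, c, rfl⟩
      · have hza : z = a := by simpa [e] using hal
        subst hza
        exact ⟨ha.ne', fun hzv => hadj (hzv ▸ ha)⟩
      · have hcz : (c, z) ∈ E := List.isChain_iff_forall_rel_of_append_cons_cons.1 hc
          (by simpa using e)
        exact ((hE c z).1 hcz).2.2
    apply exists_path_of_isChain
    · rw [← List.cons_append, List.isChain_append, List.isChain_cons]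
      refine ⟨⟨fun c hc' => ?_, hc.imp fun a b hab => ((hE a b).1 hab).1⟩, by simp, ?_⟩
      · rwa [Option.mem_unique hc' hal]
      · intro c hc' d hd'
        rw [List.getLast?_cons, Option.mem_def.1 hbl] at hc'
        simp at hc' hd'
        subst hc' hd'
        exact hb
    · have hu : u ∉ p i := fun h => (hmem u h).1 rfl
      have hv : v ∉ p i := fun h => (hmem v h).2 rfl
      simp [hu, huv, List.nodup_append, hn]
      rintro z hz rfl
      exact hv hz
  choose P hP using hpath
  refine ⟨P, fun i => ?_, fun i j hij => ?_⟩
  · have hl := congrArg List.length (hP i)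
    have : 0 < (p i).length := by
      obtain ⟨a, -, ha⟩ := (hp i).1.head
      exact List.length_pos_of_mem (List.mem_of_mem_head? ha)
    simp at hl
    omega
  · simpa [hP] using hd i j hij

theorem card_le_of_internallyDisjointPaths {V : Type*} [Fintype V] {G : SimpleGraph V} {u v : V}
    {n : ℕ} {P : Fin n → G.Path u v} (hP : InternallyDisjointPaths G P) :
    n ≤ Fintype.card V := by
  have hne : ∀ i, ∃ z, z ∈ (P i).val.support.tail.dropLast := by
    intro i
    apply List.exists_mem_of_length_pos
    have := hP.1 i
    simp
    omega
  choose f hf using hne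
  have hinj : Function.Injective f := by
    intro i j hij
    by_contra h
    exact hP.2 i j h (hf i) (hij ▸ hf j)
  simpa using Fintype.card_le_of_injective f hinj

theorem le_kappaMax {V : Type*} [Fintype V] {G : SimpleGraph V} {u v : V} (huv : u ≠ v) {n : ℕ}
    {P : Fin n → G.Path u v} (hP : InternallyDisjointPaths G P) : n ≤ kappaMax G := by
  have hle : n ≤ kappa G u v :=
    le_csSup ⟨Fintype.card V, fun _ ⟨_, hQ⟩ => card_le_of_internallyDisjointPaths hQ⟩ ⟨P, hP⟩
  refine hle.trans (le_csSup (Set.Finite.bddAbove ?_) ⟨u, v, huv, rfl⟩)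
  refine (Set.finite_range fun w : V × V => kappa G w.1 w.2).subset ?_
  rintro _ ⟨a, b, -, rfl⟩
  exact ⟨(a, b), rfl⟩

theorem InternallyDisjointPaths.mapLe {V : Type*} {G H : SimpleGraph V} (hGH : G ≤ H) {u v : V}
    {n : ℕ} {P : Fin n → G.Path u v} (hP : InternallyDisjointPaths G P) :
    InternallyDisjointPaths H fun i =>
      (⟨(P i).val.mapLe hGH, (SimpleGraph.Walk.isPath_mapLe hGH).2 (P i).property⟩ : H.Path u v) := by
  simpa [InternallyDisjointPaths] using hP

/-- Let `H` be the graph in which distinct `u, v` are adjacent iff no set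
`S ⊆ V(G) ∖ {u,v}` of size at most `k` separates `u` from `v` in `G ∖ S`.
If `κ(H) ≤ k`, then `G = H`. -/
theorem stmt7 {V : Type*} [Fintype V] (G H : SimpleGraph V) (k : ℤ)
    (hHdef : ∀ u v : V, H.Adj u v ↔
      (u ≠ v ∧ ¬ ∃ S : Finset V, u ∉ S ∧ v ∉ S ∧ (S.card : ℤ) ≤ k ∧ ¬ ConnAvoiding G ↑S u v))
    (hkH : (kappaMax H : ℤ) ≤ k) :
    G = H := by
  have hle : G ≤ H := by
    intro u v hadj
    rw [hHdef]
    refine ⟨hadj.ne, fun ⟨S, hu, hv, _, hS⟩ => hS ⟨hadj.toWalk, ?_⟩⟩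
    simp [hu, hv]
  refine le_antisymm hle fun u v hadj => ?_
  by_contra hG
  obtain ⟨huv, hS⟩ := (hHdef u v).1 hadj
  obtain ⟨P, hP⟩ := exists_internallyDisjointPaths huv hG (n := kappaMax H + 1)
    fun S hu hv hsep => by
      by_contra! hlt
      exact hS ⟨S, hu, hv, by omega, hsep⟩
  have := le_kappaMax huv (hP.mapLe hle)
  omega
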